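/- arXiv:1704.06820 — 2 statements merged into one kernel-verified Lean document; each statement's English description precedes it below -/
import Mathlib

section
/- For a natural number k let T(k) denote the number of triples (a, b, c) of natural numbers with a + b + c = k (so T(k) = C(k+2, 2)). Let p be a prime. Then for all integers i ≥ 0, n, m ≥ 1 and d ≥ n + m, one has T(p^i · d) − T(p^i · (d−n)) − T(p^i · (d−m)) + T(p^i · (d−n−m)) = p^{2i} · n · m. (This is the paper's braided Bezout theorem in ℙ^{2,ad,perf}_K: the grade-i entry of the braided dimension of ⊕_P O_P/(f,g) equals (p^i n)(p^i m), the first grade i = 0 recovering the classical Bezout number nm.) -/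
open Finset in
theorem two_mul_ncard_triples_sum_eq (k : ℕ) :
    2 * {abc : ℕ × ℕ × ℕ | abc.1 + abc.2.1 + abc.2.2 = k}.ncard = (k + 1) * (k + 2) := by
  have hset : {abc : ℕ × ℕ × ℕ | abc.1 + abc.2.1 + abc.2.2 = k} =
      (((antidiagonal k).sigma fun x => antidiagonal x.1).image
        fun y => (y.2.1, y.2.2, y.1.2) : Finset (ℕ × ℕ × ℕ)) := by
    ext ⟨a, b, c⟩
    simp only [Set.mem_ofPred_eq, coe_image, Set.mem_image, mem_coe, mem_sigma,
      HasAntidiagonal.mem_antidiagonal, Prod.mk.injEq]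
    constructor
    · intro h
      exact ⟨⟨(a + b, c), (a, b)⟩, ⟨h, rfl⟩, rfl, rfl, rfl⟩
    · rintro ⟨⟨⟨u, v⟩, w, x⟩, ⟨h₁, h₂⟩, rfl, rfl, rfl⟩
      simp only at h₁ h₂ ⊢
      omega
  rw [hset, Set.ncard_coe_finset, card_image_of_injOn, card_sigma]
  · simp only [Nat.card_antidiagonal]
    rw [Nat.sum_antidiagonal_eq_sum_range_succ_mk]
    clear hset
    induction k with
    | zero => simp
    | succ k ih =>
      rw [sum_range_succ, mul_add, ih]
      ring
  · rintro ⟨⟨u, v⟩, w, x⟩ h ⟨⟨u', v'⟩, w', x'⟩ h' heq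
    simp only [coe_sigma, Set.mem_sigma_iff, mem_coe, HasAntidiagonal.mem_antidiagonal, Prod.mk.injEq] at h h' heq
    obtain ⟨rfl, rfl, rfl⟩ := heq
    obtain ⟨-, rfl⟩ := h
    obtain ⟨-, rfl⟩ := h'
    rfl

/-- With `T k` the number of triples of natural numbers summing to `k`, and
`p` prime, for all `i ≥ 0`, `n, m ≥ 1`, `d ≥ n + m` one has
`T(p^i d) − T(p^i (d−n)) − T(p^i (d−m)) + T(p^i (d−n−m)) = p^(2i) * n * m`. -/
theorem statement8 (T : ℕ → ℕ)
    (hT : ∀ k : ℕ, T k = {abc : ℕ × ℕ × ℕ | abc.1 + abc.2.1 + abc.2.2 = k}.ncard)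
    (p : ℕ) (hp : p.Prime) (i n m d : ℕ) (hn : 1 ≤ n) (hm : 1 ≤ m) (hd : n + m ≤ d) :
    (T (p ^ i * d) : ℤ) - T (p ^ i * (d - n)) - T (p ^ i * (d - m))
      + T (p ^ i * (d - n - m)) = p ^ (2 * i) * n * m := by
  have key (k : ℕ) : 2 * (T k : ℤ) = (k + 1) * (k + 2) := by
    rw [hT]
    exact_mod_cast two_mul_ncard_triples_sum_eq k
  obtain ⟨e, rfl⟩ := Nat.exists_eq_add_of_le hd
  rw [show n + m + e - n - m = e by omega, show n + m + e - n = m + e by omega,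
    show n + m + e - m = n + e by omega]
  have h₁ := key (p ^ i * (n + m + e))
  have h₂ := key (p ^ i * (m + e))
  have h₃ := key (p ^ i * (n + e))
  have h₄ := key (p ^ i * e)
  push_cast at h₁ h₂ h₃ h₄
  rw [mul_comm 2 i, pow_mul]
  apply mul_left_cancel₀ (two_ne_zero (α := ℤ))
  linear_combination h₁ - h₂ - h₃ + h₄
end

section
/- Let K be a field and p a prime number, and let M denote the additive monoid of nonnegative rationals whose denominator is a power of p (M = ℤ[1/p]_{≥0}). Then the monoid algebra K[M] (the additive monoid algebra of M over K, i.e., the ring of polynomials in X with exponents in ℤ[1/p]_{≥0}, the union of the chain K[X] ⊂ K[X^{1/p}] ⊂ K[X^{1/p²}] ⊂ ...) is not a Noetherian ring. (This is the paper's observation that in the tower K[X] ⊂ K[X^{1/p}] ⊂ K[X^{1/p²}] ⊂ ... every ring is Noetherian except the one obtained in the limit.) -/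
/-- If one monomial divides another in a monoid algebra, then so do their exponents additively. -/
theorem exists_eq_add_of_single_dvd_single {R M : Type*} [CommSemiring R] [Nontrivial R]
    [AddCommMonoid M] {a b : M}
    (h : (AddMonoidAlgebra.single a 1 : AddMonoidAlgebra R M) ∣ AddMonoidAlgebra.single b 1) :
    ∃ c, b = a + c := by
  obtain ⟨f, hf⟩ := h
  by_contra hc
  have hb := AddMonoidAlgebra.coeff_single_mul_of_forall_add_ne (1 : R) f
    fun c hac ↦ hc ⟨c, hac.symm⟩
  rw [← hf] at hb
  simp at hb

/-- A strictly descending divisibility chain of exponents prevents a monoid algebra from being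
Noetherian. -/
theorem not_isNoetherianRing_addMonoidAlgebra {R M : Type*} [CommRing R] [Nontrivial R]
    [AddCommMonoid M] (a : ℕ → M) (h : ∀ n, ∃ c, a n = a (n + 1) + c)
    (h' : ∀ n, ¬ ∃ c, a (n + 1) = a n + c) :
    ¬ IsNoetherianRing (AddMonoidAlgebra R M) := by
  intro _
  let x (n : ℕ) : AddMonoidAlgebra R M := AddMonoidAlgebra.single (a n) 1
  have hx : Monotone fun n ↦ Ideal.span {x n} := monotone_nat_of_le_succ fun n ↦ by
    obtain ⟨c, hc⟩ := h n
    refine Ideal.span_singleton_le_span_singleton.2 ⟨AddMonoidAlgebra.single c 1, ?_⟩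
    simp [x, hc, AddMonoidAlgebra.single_mul_single]
  obtain ⟨n, hn⟩ := monotone_stabilizes_iff_noetherian.2 ‹_› ⟨_, hx⟩
  have hle : Ideal.span {x (n + 1)} ≤ Ideal.span {x n} := (hn (n + 1) n.le_succ).ge
  exact h' n (exists_eq_add_of_single_dvd_single (Ideal.span_singleton_le_span_singleton.1 hle))

/-- Let `K` be a field, `p` a prime, and `M` the additive monoid of
nonnegative rationals whose denominator is a power of `p` (`M = ℤ[1/p]_{≥0}`). Then the
additive monoid algebra `K[M]` is not a Noetherian ring. -/
theorem statement10 (K : Type*) [Field K] (p : ℕ) (hp : p.Prime)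
    (M : AddSubmonoid ℚ)
    (hM : ∀ q : ℚ, q ∈ M ↔ 0 ≤ q ∧ ∃ a k : ℕ, q = (a : ℚ) / (p : ℚ) ^ k) :
    ¬ IsNoetherianRing (AddMonoidAlgebra K M) := by
  have hp0 : (0 : ℚ) < p := by exact_mod_cast hp.pos
  have hmem (a k : ℕ) : (a : ℚ) / (p : ℚ) ^ k ∈ M := (hM _).2 ⟨by positivity, a, k, rfl⟩
  refine not_isNoetherianRing_addMonoidAlgebra (fun n ↦ ⟨_, hmem 1 n⟩) (fun n ↦ ?_) ?_
  · refine ⟨⟨_, hmem (p - 1) (n + 1)⟩, Subtype.ext ?_⟩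
    simp only [AddSubmonoid.coe_add, Nat.cast_sub hp.one_le]
    field_simp
    push_cast
    ring
  · rintro n ⟨c, hc⟩
    have hc' := congrArg Subtype.val hc
    have hc0 : (0 : ℚ) ≤ c := ((hM c).1 c.2).1
    have hlt : (1 : ℚ) / (p : ℚ) ^ (n + 1) < 1 / (p : ℚ) ^ n :=
      one_div_lt_one_div_of_lt (by positivity)
        (pow_lt_pow_right₀ (by exact_mod_cast hp.one_lt) n.lt_succ_self)
    simp only [AddSubmonoid.coe_add, Nat.cast_one] at hc'
    linarith
end
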